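/- Let F be a field with a fixed algebraic closure F̄, let A be a reduced finitely generated commutative F-algebra, and let G be a finite group acting on A by F-algebra automorphisms such that the induced action of G on Hom_{F-alg}(A, F̄) (by precomposition with g⁻¹) is free. Then the A-algebra homomorphism A ⊗_{A^G} A → ∏_{g ∈ G} A determined by a ⊗ b ↦ (a · g(b))_{g ∈ G} is an isomorphism of rings. -/

import Mathlib

open scoped TensorProduct

/-- The subalgebra of invariants of a group acting by `F`-algebra automorphisms. -/
def invariantSubalgebra (F A : Type*) [CommSemiring F] [CommSemiring A] [Algebra F A]
    {G : Type*} [Group G] (ρ : G →* (A ≃ₐ[F] A)) : Subalgebra F A where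
  carrier := {a | ∀ g : G, ρ g a = a}
  mul_mem' := fun {a b} ha hb g => by simp only [map_mul, ha g, hb g]
  add_mem' := fun {a b} ha hb g => by simp only [map_add, ha g, hb g]
  algebraMap_mem' := fun c g => by simp

/-- The `g`-component `a ⊗ b ↦ a * g b` of the map `A ⊗[A^G] A → ∏ g, A`. -/
noncomputable def twistedMul {F A G : Type*} [Field F] [CommRing A] [Algebra F A] [Group G]
    (ρ : G →* (A ≃ₐ[F] A)) (g : G) :
    A ⊗[invariantSubalgebra F A ρ] A →ₐ[invariantSubalgebra F A ρ] A :=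
  Algebra.TensorProduct.productMap (AlgHom.id _ A)
    { (ρ g : A →+* A) with commutes' := fun b => b.2 g }

section

variable {F A G : Type*} [Field F] [CommRing A] [Algebra F A] [Group G] (ρ : G →* (A ≃ₐ[F] A))

lemma twistedMul_tmul (g : G) (a b : A) :
    twistedMul ρ g (a ⊗ₜ[invariantSubalgebra F A ρ] b) = a * ρ g b :=
  Algebra.TensorProduct.productMap_apply_tmul _ _ a b

lemma twistedMul_surjective (g : G) : Function.Surjective (twistedMul ρ g) := fun a =>
  ⟨a ⊗ₜ 1, by simp [twistedMul_tmul]⟩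

/-- Over a finitely generated algebra, an automorphism fixing no geometric point has no fixed
point at any maximal ideal. -/
lemma exists_sub_notMem_of_isMaximal [Algebra.FiniteType F A] (σ : A ≃ₐ[F] A)
    (hσ : ∀ φ : A →ₐ[F] AlgebraicClosure F, φ.comp σ.toAlgHom ≠ φ)
    (m : Ideal A) [m.IsMaximal] : ∃ a, a - σ a ∉ m := by
  by_contra! h
  let : Field (A ⧸ m) := Ideal.Quotient.field m
  have : Module.Finite F (A ⧸ m) := finite_of_finite_type_of_isJacobsonRing F (A ⧸ m)
  let ψ : (A ⧸ m) →ₐ[F] AlgebraicClosure F := IsAlgClosed.lift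
  refine hσ (ψ.comp (Ideal.Quotient.mkₐ F m)) (AlgHom.ext fun a => ?_)
  have : Ideal.Quotient.mk m (σ a) = Ideal.Quotient.mk m a :=
    (Ideal.Quotient.eq.mpr (h a)).symm
  exact congrArg ψ this

/-- If `g` fixes no geometric point, the graph of `g` can be separated from the diagonal. -/
lemma exists_twistedMul_eq_one_and_eq_zero [Algebra.FiniteType F A] (g : G)
    (hg : ∀ φ : A →ₐ[F] AlgebraicClosure F, φ.comp (ρ g).toAlgHom ≠ φ) :
    ∃ t, twistedMul ρ 1 t = 1 ∧ twistedMul ρ g t = 0 := by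
  have htop : Ideal.map (twistedMul ρ 1) (RingHom.ker (twistedMul ρ g)) = ⊤ := by
    by_contra hne
    obtain ⟨m, hm, hle⟩ := Ideal.exists_le_maximal _ hne
    obtain ⟨a, ha⟩ := exists_sub_notMem_of_isMaximal (ρ g) hg m
    refine ha (hle ?_)
    have hker : (1 ⊗ₜ a - ρ g a ⊗ₜ 1 : A ⊗[invariantSubalgebra F A ρ] A) ∈
        RingHom.ker (twistedMul ρ g) := by
      simp [RingHom.mem_ker, twistedMul_tmul]
    simpa [twistedMul_tmul] using Ideal.mem_map_of_mem (twistedMul ρ 1) hker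
  obtain ⟨t, ht, h1⟩ := (Ideal.mem_map_iff_of_surjective _ (twistedMul_surjective ρ 1)).mp
    (htop ▸ Submodule.mem_top : (1 : A) ∈ _)
  exact ⟨t, h1, ht⟩

/-- For a free action, the diagonal is cut out by an element that is `1` on the graph of `1` and `0` on
the graph of every other group element. -/
lemma exists_twistedMul_eq_single [Algebra.FiniteType F A] [Finite G]
    (hfree : ∀ (g : G) (φ : A →ₐ[F] AlgebraicClosure F),
      φ.comp (ρ g).toAlgHom = φ → g = 1) :
    ∃ e, twistedMul ρ 1 e = 1 ∧ ∀ g ≠ 1, twistedMul ρ g e = 0 := by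
  classical
  have := Fintype.ofFinite G
  have H (g : G) : ∃ t, twistedMul ρ 1 t = 1 ∧ (g ≠ 1 → twistedMul ρ g t = 0) := by
    by_cases hg : g = 1
    · exact ⟨1, map_one _, fun h => absurd hg h⟩
    · obtain ⟨t, h1, h2⟩ := exists_twistedMul_eq_one_and_eq_zero ρ g
        fun φ h => hg (hfree g φ h)
      exact ⟨t, h1, fun _ => h2⟩
  choose t h1 h2 using H
  refine ⟨∏ g, t g, by simp [map_prod, h1], fun g hg => ?_⟩
  rw [map_prod]
  exact Finset.prod_eq_zero (Finset.mem_univ g) (h2 g hg)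

/-- For a free action there are Galois coordinates `x i`, `y i` with
`∑ i, x i * g (y i) = δ_{g, 1}`. -/
lemma exists_galois_coordinates [Algebra.FiniteType F A] [Finite G] [DecidableEq G]
    (hfree : ∀ (g : G) (φ : A →ₐ[F] AlgebraicClosure F),
      φ.comp (ρ g).toAlgHom = φ → g = 1) :
    ∃ s : Finset (A × A), ∀ g, ∑ i ∈ s, i.1 * ρ g i.2 = if g = 1 then 1 else 0 := by
  obtain ⟨e, h1, h2⟩ := exists_twistedMul_eq_single ρ hfree
  obtain ⟨s, rfl⟩ := TensorProduct.exists_finset e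
  refine ⟨s, fun g => ?_⟩
  split_ifs with hg
  · subst hg
    simpa only [map_sum, twistedMul_tmul] using h1
  · simpa only [map_sum, twistedMul_tmul] using h2 g hg

/-- The trace of an element lies in the invariants. -/
lemma sum_mem_invariantSubalgebra [Fintype G] (a : A) :
    ∑ g, ρ g a ∈ invariantSubalgebra F A ρ := fun h => by
  rw [map_sum]
  exact Fintype.sum_equiv (Equiv.mulLeft h) _ _ fun g => by simp

/-- Galois coordinates reconstruct a tensor from its twisted multiplications. -/
lemma sum_twistedMul_tmul_eq [Fintype G] [DecidableEq G] (s : Finset (A × A))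
    (hs : ∀ g, ∑ i ∈ s, i.1 * ρ g i.2 = if g = 1 then 1 else 0)
    (z : A ⊗[invariantSubalgebra F A ρ] A) :
    ∑ i ∈ s, (∑ g, twistedMul ρ g z * ρ g i.2) ⊗ₜ[invariantSubalgebra F A ρ] i.1 = z := by
  induction z with
  | zero => simp
  | add z w hz hw =>
    simp only [map_add, add_mul, Finset.sum_add_distrib, TensorProduct.add_tmul, hz, hw]
  | tmul a b =>
    have key (i : A × A) : (∑ g, twistedMul ρ g (a ⊗ₜ b) * ρ g i.2)
        ⊗ₜ[invariantSubalgebra F A ρ] i.1 = a ⊗ₜ ((∑ g, ρ g (b * i.2)) * i.1) := by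
      let c : invariantSubalgebra F A ρ := ⟨_, sum_mem_invariantSubalgebra ρ (b * i.2)⟩
      have h1 : ∑ g, twistedMul ρ g (a ⊗ₜ b) * ρ g i.2 = c • a := by
        simp only [twistedMul_tmul, c, Subalgebra.smul_def, smul_eq_mul, Finset.sum_mul, map_mul]
        exact Finset.sum_congr rfl fun g _ => by ring
      rw [h1, TensorProduct.smul_tmul]
      rfl
    simp only [key, ← TensorProduct.tmul_sum]
    congr 1
    calc ∑ i ∈ s, (∑ g, ρ g (b * i.2)) * i.1
        = ∑ g, ρ g b * ∑ i ∈ s, i.1 * ρ g i.2 := by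
          simp only [Finset.sum_mul, Finset.mul_sum]
          rw [Finset.sum_comm]
          exact Finset.sum_congr rfl fun g _ => Finset.sum_congr rfl fun i _ => by
            rw [map_mul]; ring
      _ = b := by simp [hs]

end

/-- Let `F` be a field with algebraic closure `F̄`, let `A` be a reduced finitely
generated commutative `F`-algebra, and let a finite group `G` act on `A` by `F`-algebra
automorphisms so that the induced action on `Hom_{F-alg}(A, F̄)` is free.  Then the
`A`-algebra homomorphism `A ⊗_{A^G} A → ∏_{g ∈ G} A`, `a ⊗ b ↦ (a · g(b))_{g ∈ G}`,
is an isomorphism of rings. -/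
theorem tensor_over_invariants_iso_product_of_free_action
    (F : Type*) [Field F] (A : Type*) [CommRing A] [IsReduced A] [Algebra F A]
    [Algebra.FiniteType F A]
    (G : Type*) [Group G] [Finite G] (ρ : G →* (A ≃ₐ[F] A))
    (hfree : ∀ (g : G) (φ : A →ₐ[F] AlgebraicClosure F),
      φ.comp (ρ g).toAlgHom = φ → g = 1) :
    ∃ Φ : (A ⊗[invariantSubalgebra F A ρ] A) →+* (G → A),
      (∀ (a b : A) (g : G), Φ (a ⊗ₜ[invariantSubalgebra F A ρ] b) g = a * ρ g b) ∧
      Function.Bijective Φ := by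
  classical
  have := Fintype.ofFinite G
  obtain ⟨s, hs⟩ := exists_galois_coordinates ρ hfree
  refine ⟨RingHom.pi fun g => (twistedMul ρ g : A ⊗[invariantSubalgebra F A ρ] A →+* A),
    fun a b g => twistedMul_tmul ρ g a b, fun z w hzw => ?_, fun c => ?_⟩
  · have h (g : G) : twistedMul ρ g z = twistedMul ρ g w := congrFun hzw g
    rw [← sum_twistedMul_tmul_eq ρ s hs z, ← sum_twistedMul_tmul_eq ρ s hs w]
    simp only [h]
  · refine ⟨∑ h, ∑ i ∈ s, (c h * i.1) ⊗ₜ ρ h⁻¹ i.2, funext fun g => ?_⟩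
    change twistedMul ρ g _ = c g
    have key (h : G) : ∑ i ∈ s, c h * i.1 * ρ g (ρ h⁻¹ i.2) = if g = h then c h else 0 := by
      have := hs (g * h⁻¹)
      simp only [map_mul, AlgEquiv.mul_apply, mul_inv_eq_one] at this
      simp only [mul_assoc, ← Finset.mul_sum, this, mul_ite, mul_one, mul_zero]
    simp only [map_sum, twistedMul_tmul, key]
    simp
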